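/- Let Y be a (complex) strictly convex Banach space and let T ∈ L(c₀;Y) be a norm attaining operator. Then T has finite support: there exists a finite set A ⊂ ℕ such that T∘(I − P_A) = 0; in particular T is a compact operator. -/

import Mathlib

noncomputable section

/-- `Y` is (complex) strictly convex: for `x ∈ S_Y`, if the maximum of `‖x + θ • y‖` over the
unit sphere of scalars `θ` equals `1`, then `y = 0`. -/
def ComplexStrictlyConvex (𝕂 : Type*) [RCLike 𝕂] (Y : Type*) [NormedAddCommGroup Y]
    [NormedSpace 𝕂 Y] : Prop :=
  ∀ x y : Y, ‖x‖ = 1 →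
    IsGreatest {r : ℝ | ∃ θ : 𝕂, ‖θ‖ = 1 ∧ r = ‖x + θ • y‖} 1 → y = 0

open scoped ZeroAtInfty

/-- The element of `c₀` obtained from `f` by keeping the coordinates in the finite set `A`
and setting the others to `0`. -/
def projFun {𝕂 : Type*} [RCLike 𝕂] (A : Finset ℕ) (f : C₀(ℕ, 𝕂)) : C₀(ℕ, 𝕂) where
  toFun n := if n ∈ A then f n else 0
  continuous_toFun := continuous_of_discreteTopology
  zero_at_infty' := by
    rw [Filter.cocompact_eq_cofinite]
    refine Filter.Tendsto.congr' ?_ tendsto_const_nhds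
    have h : {n : ℕ | ¬ (0 : 𝕂) = if n ∈ A then f n else 0}.Finite := by
      apply (A : Set ℕ).toFinite.subset
      intro n hn
      simp only [Set.mem_setOf_eq] at hn
      by_contra hA
      rw [Finset.mem_coe] at hA
      exact hn (by rw [if_neg hA])
    exact Filter.eventually_cofinite.mpr h

lemma projFun_norm_le {𝕂 : Type*} [RCLike 𝕂] (A : Finset ℕ) (f : C₀(ℕ, 𝕂)) :
    ‖projFun A f‖ ≤ ‖f‖ := by
  rw [← ZeroAtInftyContinuousMap.norm_toBCF_eq_norm, ← ZeroAtInftyContinuousMap.norm_toBCF_eq_norm]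
  refine (BoundedContinuousFunction.norm_le (norm_nonneg _)).mpr fun n => ?_
  show ‖if n ∈ A then f n else 0‖ ≤ _
  split
  · exact BoundedContinuousFunction.norm_coe_le_norm f.toBCF n
  · simp

/-- The canonical projection `P_A : c₀ → c₀` onto the coordinates in a finite set `A ⊆ ℕ`. -/
def projC0 (𝕂 : Type*) [RCLike 𝕂] (A : Finset ℕ) : C₀(ℕ, 𝕂) →L[𝕂] C₀(ℕ, 𝕂) :=
  LinearMap.mkContinuous
    { toFun := projFun A
      map_add' := fun f g => by
        ext n
        show (if n ∈ A then (f + g) n else 0)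
          = (if n ∈ A then f n else 0) + (if n ∈ A then g n else 0)
        split <;> simp
      map_smul' := fun c f => by
        ext n
        show (if n ∈ A then (c • f) n else 0) = c • (if n ∈ A then f n else 0)
        split <;> simp }
    1 (fun f => by simpa using projFun_norm_le A f)

open Filter

lemma c0_norm_le_iff {𝕂 : Type*} [RCLike 𝕂] {f : C₀(ℕ, 𝕂)} {r : ℝ} (hr : 0 ≤ r) :
    ‖f‖ ≤ r ↔ ∀ n, ‖f n‖ ≤ r := by
  rw [← ZeroAtInftyContinuousMap.norm_toBCF_eq_norm]
  exact BoundedContinuousFunction.norm_le hr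

@[simp]
lemma projC0_apply {𝕂 : Type*} [RCLike 𝕂] (A : Finset ℕ) (f : C₀(ℕ, 𝕂)) (n : ℕ) :
    projC0 𝕂 A f n = if n ∈ A then f n else 0 :=
  rfl

lemma finite_setOf_le_norm_c0 {𝕂 : Type*} [RCLike 𝕂] (x : C₀(ℕ, 𝕂)) {ε : ℝ} (hε : 0 < ε) :
    {n : ℕ | ε ≤ ‖x n‖}.Finite := by
  have h : Tendsto (fun n => ‖x n‖) cofinite (nhds 0) := by
    have := (zero_at_infty x).norm
    rwa [cocompact_eq_cofinite, norm_zero] at this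
  simpa using eventually_cofinite.mp (h.eventually_lt_const hε)

lemma isCompactOperator_projC0 {𝕂 : Type*} [RCLike 𝕂] (A : Finset ℕ) :
    IsCompactOperator (projC0 𝕂 A) := by
  let V := LinearMap.range (projC0 𝕂 A : C₀(ℕ, 𝕂) →ₗ[𝕂] C₀(ℕ, 𝕂))
  let E : V →ₗ[𝕂] (A → 𝕂) :=
    { toFun := fun f n => (f : C₀(ℕ, 𝕂)) n
      map_add' := fun _ _ => rfl
      map_smul' := fun _ _ => rfl }
  have hE : Function.Injective E := by
    rintro ⟨_, f, rfl⟩ ⟨_, g, rfl⟩ h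
    ext n
    by_cases hn : n ∈ A
    · exact congrFun h ⟨n, hn⟩
    · simp [hn]
  have : FiniteDimensional 𝕂 V := FiniteDimensional.of_injective E hE
  have : ProperSpace V := FiniteDimensional.proper 𝕂 V
  let R : C₀(ℕ, 𝕂) →L[𝕂] V := (projC0 𝕂 A).codRestrict V fun f => ⟨f, rfl⟩
  exact (isCompactOperator_of_locallyCompactSpace_dom R).clm_comp V.subtypeL

/-- In a complex strictly convex space, a vector `v` all of whose rotations keep `u + θ • v`
in the ball of radius `‖u‖` vanishes. -/
lemma ComplexStrictlyConvex.eq_zero_of_norm_add_smul_le {𝕂 Y : Type*} [RCLike 𝕂]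
    [NormedAddCommGroup Y] [NormedSpace 𝕂 Y] (hY : ComplexStrictlyConvex 𝕂 Y) {u v : Y}
    (hu : u ≠ 0) (h : ∀ θ : 𝕂, ‖θ‖ = 1 → ‖u + θ • v‖ ≤ ‖u‖) : v = 0 := by
  have hu' : 0 < ‖u‖ := norm_pos_iff.mpr hu
  set c : 𝕂 := ((‖u‖⁻¹ : ℝ) : 𝕂) with hc
  have hcn : ‖c‖ = ‖u‖⁻¹ := by simp [hc]
  have hc0 : c ≠ 0 := by rw [← norm_pos_iff, hcn]; positivity
  have hscale (θ : 𝕂) : ‖c • u + θ • c • v‖ = ‖u‖⁻¹ * ‖u + θ • v‖ := by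
    rw [smul_comm θ c v, ← smul_add, norm_smul, hcn]
  have hcu : ‖c • u‖ = 1 := by rw [norm_smul, hcn, inv_mul_cancel₀ hu'.ne']
  have hle (θ : 𝕂) (hθ : ‖θ‖ = 1) : ‖c • u + θ • c • v‖ ≤ 1 := by
    rw [hscale, ← inv_mul_cancel₀ hu'.ne']
    exact mul_le_mul_of_nonneg_left (h θ hθ) (by positivity)
  have hge : 1 ≤ ‖c • u + (1 : 𝕂) • c • v‖ := by
    have hsum : (c • u + (1 : 𝕂) • c • v) + (c • u + (-1 : 𝕂) • c • v) = (2 : 𝕂) • c • u := by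
      module
    have htri := norm_add_le (c • u + (1 : 𝕂) • c • v) (c • u + (-1 : 𝕂) • c • v)
    rw [hsum, norm_smul, hcu, RCLike.norm_ofNat] at htri
    linarith [hle (-1) (by simp)]
  have hcv : c • v = 0 := by
    refine hY (c • u) (c • v) hcu ⟨⟨1, by simp, ?_⟩, ?_⟩
    · exact le_antisymm hge (hle 1 (by simp))
    · rintro _ ⟨θ, hθ, rfl⟩
      exact hle θ hθ
  exact (smul_eq_zero.mp hcv).resolve_left hc0

/-- If `Y` is (complex) strictly convex, every norm attaining operator `T : c₀ → Y` has
finite support, and in particular is compact. -/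
theorem finite_support_of_normAttaining_complexStrictlyConvex {𝕂 Y : Type*} [RCLike 𝕂]
    [NormedAddCommGroup Y] [NormedSpace 𝕂 Y] [CompleteSpace Y]
    (hY : ComplexStrictlyConvex 𝕂 Y) (T : C₀(ℕ, 𝕂) →L[𝕂] Y)
    (hNA : ∃ x : C₀(ℕ, 𝕂), ‖x‖ = 1 ∧ ‖T x‖ = ‖T‖) :
    (∃ A : Finset ℕ, T.comp (ContinuousLinearMap.id 𝕂 C₀(ℕ, 𝕂) - projC0 𝕂 A) = 0) ∧
      IsCompactOperator ⇑T := by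
  have hfin : ∃ A : Finset ℕ,
      T.comp (ContinuousLinearMap.id 𝕂 C₀(ℕ, 𝕂) - projC0 𝕂 A) = 0 := by
    obtain ⟨x, hx, hTx⟩ := hNA
    rcases eq_or_ne (T x) 0 with h0 | h0
    · have hT (f : C₀(ℕ, 𝕂)) : T f = 0 := by
        simpa [← hTx, h0] using T.le_opNorm f
      exact ⟨∅, ContinuousLinearMap.ext fun f => hT _⟩
    have hxn := (c0_norm_le_iff zero_le_one).mp hx.le
    set A : Finset ℕ := (finite_setOf_le_norm_c0 x (one_half_pos (α := ℝ))).toFinset with hA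
    have hker (g : C₀(ℕ, 𝕂)) (hg : ‖g‖ ≤ 1 / 2) (hgA : ∀ n ∈ A, g n = 0) : T g = 0 := by
      refine hY.eq_zero_of_norm_add_smul_le h0 fun θ hθ => ?_
      have hball : ‖x + θ • g‖ ≤ 1 := by
        refine (c0_norm_le_iff zero_le_one).mpr fun n => ?_
        rw [ZeroAtInftyContinuousMap.add_apply, ZeroAtInftyContinuousMap.smul_apply]
        by_cases hn : n ∈ A
        · simpa [hgA n hn] using hxn n
        · have hxs : ‖x n‖ < 1 / 2 := by simpa [hA] using hn
          have hgs : ‖θ • g n‖ ≤ 1 / 2 := by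
            rw [norm_smul, hθ, one_mul]
            exact (c0_norm_le_iff one_half_pos.le).mp hg n
          linarith [norm_add_le (x n) (θ • g n)]
      rw [← map_smul, ← map_add, hTx]
      exact T.le_of_opNorm_le_of_le le_rfl hball |>.trans_eq (mul_one _)
    refine ⟨A, ContinuousLinearMap.ext fun f => ?_⟩
    set g : C₀(ℕ, 𝕂) := f - projC0 𝕂 A f with hg
    have hgA (n : ℕ) (hn : n ∈ A) : g n = 0 := by simp [hg, hn]
    set c : 𝕂 := (((2 * (‖g‖ + 1))⁻¹ : ℝ) : 𝕂) with hc
    have hpos : 0 < 2 * (‖g‖ + 1) := by positivity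
    have hcn : ‖c‖ = (2 * (‖g‖ + 1))⁻¹ := by
      rw [hc, RCLike.norm_ofReal, abs_of_pos (inv_pos.mpr hpos)]
    have hc0 : c ≠ 0 := by rw [← norm_pos_iff, hcn]; positivity
    have hcg : T (c • g) = 0 := by
      refine hker _ ?_ fun n hn => by simp [hgA n hn]
      rw [norm_smul, hcn, inv_mul_le_iff₀ hpos]
      linarith
    rw [map_smul] at hcg
    exact (smul_eq_zero.mp hcg).resolve_left hc0
  refine ⟨hfin, ?_⟩
  obtain ⟨A, hA⟩ := hfin
  have hT : T = T.comp (projC0 𝕂 A) := by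
    ext f
    have hf : T (f - projC0 𝕂 A f) = 0 := DFunLike.congr_fun hA f
    rwa [map_sub, sub_eq_zero] at hf
  rw [hT]
  exact (isCompactOperator_projC0 A).clm_comp T
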